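/- arXiv:1902.00834 — 3 statements merged into one kernel-verified Lean document; each statement's English description precedes it below -/
import Mathlib

section
/- Let χ_1, χ_2, s ∈ P^K (same constant total sum) with χ_1 ≺ s and χ_2 ≺ s, and define d(χ_1, χ_2) := H(χ_1) + H(χ_2) − 2·H(χ_1 ∨ χ_2). Then H(χ_1) + H(χ_2) ≥ 2·H(s) + d(χ_1, χ_2). Moreover, d(χ_1, χ_2) > 0 whenever χ_1 ≠ χ_2. -/
/-- The nonincreasing rearrangement `a↓` of a vector `a : Fin N → ℝ`. -/
noncomputable def sortDesc {N : ℕ} (a : Fin N → ℝ) : Fin N → ℝ :=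
  fun i => a (Tuple.sort a (Fin.rev i))

/-- `pSum a k` is the sum of the `k` largest entries of `a`,
i.e. `Σ_{i=1}^k a↓_i`. -/
noncomputable def pSum {N : ℕ} (a : Fin N → ℝ) (k : ℕ) : ℝ :=
  ∑ i ∈ Finset.univ.filter (fun i : Fin N => (i : ℕ) < k), sortDesc a i

/-- Majorization `a ≺ b`. -/
noncomputable def Maj {N : ℕ} (a b : Fin N → ℝ) : Prop :=
  (∀ k : ℕ, pSum a k ≤ pSum b k) ∧ (∑ i, a i = ∑ i, b i)

/-- `P^N` with total sum `c`: entries in `[0,1]`, nonincreasing, summing to `c`. -/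
def Pset (N : ℕ) (c : ℝ) : Set (Fin N → ℝ) :=
  {p | (∀ i, 0 ≤ p i ∧ p i ≤ 1) ∧ (∀ i j : Fin N, i ≤ j → p j ≤ p i) ∧ ∑ i, p i = c}

/-- Shannon entropy `H(p) = −Σ_i p_i log p_i` (with `0 log 0 = 0`). -/
noncomputable def shannonH {N : ℕ} (p : Fin N → ℝ) : ℝ :=
  -∑ i, p i * Real.log (p i)

theorem sortDesc_of_anti {N : ℕ} (p : Fin N → ℝ) (hp : ∀ i j : Fin N, i ≤ j → p j ≤ p i) :
    sortDesc p = p := by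
  have h : p ∘ (Fin.revPerm : Equiv.Perm (Fin N)) = p ∘ Tuple.sort p := by
    rw [Tuple.comp_sort_eq_comp_iff_monotone]
    intro i j hij
    exact hp _ _ (by simpa using hij)
  funext i
  have := congrFun h (Fin.rev i)
  simp only [Function.comp, Fin.revPerm_apply, Fin.rev_rev] at this
  simp only [sortDesc]
  exact this.symm

theorem abel_aux (n : ℕ) : ∀ (g x : Fin (n + 1) → ℝ), (∀ i j, i ≤ j → g j ≤ g i) →
    (∀ k : ℕ, 0 ≤ ∑ i : Fin (n + 1), if (i : ℕ) < k then x i else 0) →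
    g (Fin.last n) * ∑ i, x i ≤ ∑ i, g i * x i := by
  induction n with
  | zero => intro g x _ _; simp
  | succ n ih =>
    intro g x hg hx
    have hx' : ∀ k : ℕ, 0 ≤ ∑ i : Fin (n + 1), if (i : ℕ) < k then x i.castSucc else 0 := by
      intro k
      have := hx (min k (n + 1))
      rw [Fin.sum_univ_castSucc] at this
      have h' : ∀ i : Fin (n + 1), (i : ℕ) ≤ n := fun i => Nat.lt_succ_iff.1 i.2
      simpa [h'] using this
    have h1 := ih (fun i => g i.castSucc) (fun i => x i.castSucc)
      (fun i j hij => hg _ _ (by simpa using hij)) hx'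
    have h2 : 0 ≤ ∑ i : Fin (n + 1), x i.castSucc := by
      have := hx' (n + 1)
      simpa only [Fin.is_lt, if_true] using this
    have h3 : g (Fin.last (n + 1)) ≤ g (Fin.last n).castSucc := hg _ _ (Fin.le_last _)
    rw [Fin.sum_univ_castSucc x, Fin.sum_univ_castSucc (fun i => g i * x i), mul_add]
    have h4 := mul_le_mul_of_nonneg_right h3 h2
    linarith

theorem abel_main {N : ℕ} (g x : Fin N → ℝ) (hg : ∀ i j, i ≤ j → g j ≤ g i)
    (hx : ∀ k : ℕ, 0 ≤ ∑ i : Fin N, if (i : ℕ) < k then x i else 0) (h0 : ∑ i, x i = 0) :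
    0 ≤ ∑ i, g i * x i := by
  cases N with
  | zero => simp
  | succ n =>
    have := abel_aux n g x hg hx
    rw [h0, mul_zero] at this
    exact this

theorem xlogx_strict {x y : ℝ} (hx : 0 ≤ x) (hy : 0 < y) (h : x ≠ y) :
    (Real.log y + 1) * (x - y) < x * Real.log x - y * Real.log y := by
  rcases hx.eq_or_lt with rfl | hx
  · simp only [zero_mul]; linarith
  · have h1 := Real.log_lt_sub_one_of_pos (div_pos hy hx) (by
      intro h2; rw [div_eq_one_iff_eq hx.ne'] at h2; exact h h2.symm)
    rw [Real.log_div hy.ne' hx.ne'] at h1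
    have h2 := mul_lt_mul_of_pos_left h1 hx
    have h3 : x * (y / x - 1) = y - x := by field_simp
    rw [h3] at h2
    linarith

theorem schur {N : ℕ} {c : ℝ} {p q : Fin N → ℝ} (hp : p ∈ Pset N c) (hq : q ∈ Pset N c)
    (h : Maj p q) : shannonH q ≤ shannonH p ∧ (p ≠ q → shannonH q < shannonH p) := by
  obtain ⟨hp1, hp2, hp3⟩ := hp
  obtain ⟨hq1, hq2, hq3⟩ := hq
  obtain ⟨hm, hsum⟩ := h
  have hx : ∀ k : ℕ, 0 ≤ ∑ i : Fin N, if (i : ℕ) < k then q i - p i else 0 := by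
    intro k
    have := hm k
    simp only [pSum, sortDesc_of_anti p hp2, sortDesc_of_anti q hq2] at this
    rw [← Finset.sum_filter, Finset.sum_sub_distrib]
    linarith
  have h0 : ∑ i, (q i - p i) = 0 := by rw [Finset.sum_sub_distrib]; linarith
  have hz : ∀ i, p i = 0 → q i = 0 := by
    have h1 := abel_main (fun i => if 0 < p i then (1 : ℝ) else 0) (fun i => q i - p i)
      (by
        intro i j hij
        have := hp2 i j hij
        split_ifs <;> linarith) hx h0
    have h2 : ∑ i, (if 0 < p i then 0 else q i) ≤ 0 := by
      have h3 : ∑ i, (if 0 < p i then 0 else q i) =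
          ∑ i, (q i - p i) - ∑ i, (if 0 < p i then (1 : ℝ) else 0) * (q i - p i) := by
        rw [← Finset.sum_sub_distrib]
        refine Finset.sum_congr rfl fun i _ => ?_
        have := (hp1 i).1
        split_ifs <;> linarith
      rw [h3]; linarith
    have hn : ∀ i ∈ Finset.univ, 0 ≤ (if 0 < p i then 0 else q i) := by
      intro i _
      have := (hq1 i).1
      split_ifs <;> linarith
    intro i hi
    have h4 := (Finset.sum_eq_zero_iff_of_nonneg hn).1
      (le_antisymm h2 (Finset.sum_nonneg hn)) i (Finset.mem_univ i)
    simpa [hi] using h4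
  have hlog : ∀ i, Real.log (p i) ≤ 0 := fun i => Real.log_nonpos (hp1 i).1 (hp1 i).2
  have hL : ∀ i, ∑ j, Real.log (p j) ≤ Real.log (p i) := by
    intro i
    have := Finset.single_le_sum (f := fun j => - Real.log (p j)) (s := Finset.univ)
      (fun j _ => by have := hlog j; linarith) (Finset.mem_univ i)
    rw [Finset.sum_neg_distrib] at this
    linarith
  set g : Fin N → ℝ := fun i => (if 0 < p i then Real.log (p i) else ∑ j, Real.log (p j)) + 1
    with hgdef
  have hg := abel_main g (fun i => q i - p i)
      (by
        intro i j hij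
        have := hp2 i j hij
        have h5 := hL i
        simp only [hgdef]
        split_ifs with ha hb hb
        · have := Real.log_le_log ha this
          linarith
        · linarith
        · linarith
        · linarith) hx h0
  have hst : ∀ i, p i ≠ q i →
      g i * (q i - p i) < q i * Real.log (q i) - p i * Real.log (p i) := by
    intro i hi
    have hpos : 0 < p i := by
      rcases (hp1 i).1.eq_or_lt with h | h
      · exact absurd (h.symm.trans (hz i h.symm).symm) hi
      · exact h
    simp only [hgdef, if_pos hpos]
    exact xlogx_strict (hq1 i).1 hpos hi.symm
  have hle : ∀ i, g i * (q i - p i) ≤ q i * Real.log (q i) - p i * Real.log (p i) := by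
    intro i
    by_cases hi : p i = q i
    · simp [hi]
    · exact (hst i hi).le
  have hH : shannonH p - shannonH q =
      ∑ i, (q i * Real.log (q i) - p i * Real.log (p i)) := by
    rw [Finset.sum_sub_distrib]; simp only [shannonH]; ring
  constructor
  · have := Finset.sum_le_sum (s := Finset.univ) (fun i _ => hle i)
    linarith
  · intro hne
    obtain ⟨i, hi⟩ := Function.ne_iff.1 hne
    have := Finset.sum_lt_sum (s := Finset.univ) (fun i _ => hle i)
      ⟨i, Finset.mem_univ i, hst i hi⟩
    linarith

/-- Corollary 2: for `χ₁, χ₂, s ∈ P^K` with `χ₁ ≺ s` and `χ₂ ≺ s`, with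
`d(χ₁,χ₂) = H(χ₁) + H(χ₂) − 2 H(χ₁ ∨ χ₂)`, one has
`H(χ₁) + H(χ₂) ≥ 2 H(s) + d(χ₁,χ₂)`, and `d(χ₁,χ₂) > 0` whenever `χ₁ ≠ χ₂`. -/
theorem entropic_uncertainty_with_metric (K : ℕ) (c : ℝ) (hc : 0 < c)
    (join : (Fin K → ℝ) → (Fin K → ℝ) → (Fin K → ℝ))
    (hjoin : ∀ p ∈ Pset K c, ∀ q ∈ Pset K c,
      join p q ∈ Pset K c ∧ Maj p (join p q) ∧ Maj q (join p q) ∧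
        ∀ t ∈ Pset K c, Maj p t → Maj q t → Maj (join p q) t)
    (χ₁ χ₂ s : Fin K → ℝ)
    (h1 : χ₁ ∈ Pset K c) (h2 : χ₂ ∈ Pset K c) (hs : s ∈ Pset K c)
    (hm1 : Maj χ₁ s) (hm2 : Maj χ₂ s) :
    let d := shannonH χ₁ + shannonH χ₂ - 2 * shannonH (join χ₁ χ₂)
    shannonH χ₁ + shannonH χ₂ ≥ 2 * shannonH s + d ∧ (χ₁ ≠ χ₂ → 0 < d) := by
  obtain ⟨hj, hj1, hj2, hj3⟩ := hjoin χ₁ h1 χ₂ h2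
  intro d
  constructor
  · have := (schur hj hs (hj3 s hs hm1 hm2)).1
    simp only [d]
    linarith
  · intro hne
    have a1 := schur h1 hj hj1
    have a2 := schur h2 hj hj2
    simp only [d]
    by_cases h : χ₁ = join χ₁ χ₂
    · have h' : χ₂ ≠ join χ₁ χ₂ := fun e => hne (h.trans e.symm)
      have := a2.2 h'
      linarith [a1.1]
    · have := a1.2 h
      linarith [a2.1]
end

section
/- Given p, q ∈ P^N (same constant total sum c), define β(p, q) = (b_1,…,b_N) by b_k := max(Σ_{j=1}^k p_j, Σ_{j=1}^k q_j) − max(Σ_{j=1}^{k−1} p_j, Σ_{j=1}^{k−1} q_j) (empty sums equal 0). Then: (1) for every t ∈ P^N with p ≺ t and q ≺ t, one has Σ_{r=1}^k t_r ≥ Σ_{r=1}^k b_r for all k ∈ {1,…,N}; and (2) if the entries of β(p, q) are nonincreasing (so that β(p, q) ∈ P^N), then β(p, q) = p ∨ q, the least upper bound of p and q. -/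
theorem aux_sortDesc {N : ℕ} (a : Fin N → ℝ) (h : ∀ i j : Fin N, i ≤ j → a j ≤ a i) :
    sortDesc a = a := by
  have h2 : Monotone (a ∘ (Fin.revPerm : Equiv.Perm (Fin N))) := by
    intro i j hij
    exact h _ _ (by simpa using hij)
  have h3 := Tuple.unique_monotone (Tuple.monotone_sort a) h2
  funext i
  have := congrFun h3 (Fin.rev i)
  simpa [sortDesc] using this

theorem aux_succ {N : ℕ} (a : Fin N → ℝ) (k : ℕ) (hk : k < N) :
    ∑ i ∈ Finset.univ.filter (fun i : Fin N => (i : ℕ) < k + 1), a i =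
    ∑ i ∈ Finset.univ.filter (fun i : Fin N => (i : ℕ) < k), a i + a ⟨k, hk⟩ := by
  have : Finset.univ.filter (fun i : Fin N => (i : ℕ) < k + 1) =
      insert ⟨k, hk⟩ (Finset.univ.filter (fun i : Fin N => (i : ℕ) < k)) := by
    ext i
    simp only [Finset.mem_filter, Finset.mem_univ, true_and, Finset.mem_insert, Fin.ext_iff]
    omega
  rw [this, Finset.sum_insert (by simp), add_comm]

theorem aux_ge {N : ℕ} (a : Fin N → ℝ) (k : ℕ) (hk : N ≤ k) :
    ∑ i ∈ Finset.univ.filter (fun i : Fin N => (i : ℕ) < k), a i = ∑ i, a i := by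
  rw [Finset.filter_true_of_mem]
  intro i _
  omega

theorem aux_maj {N : ℕ} (a b : Fin N → ℝ) (ha : ∀ i j : Fin N, i ≤ j → a j ≤ a i)
    (hb : ∀ i j : Fin N, i ≤ j → b j ≤ b i) (hs : ∑ i, a i = ∑ i, b i) :
    Maj a b ↔ ∀ k ≤ N, ∑ i ∈ Finset.univ.filter (fun i : Fin N => (i : ℕ) < k), a i ≤
      ∑ i ∈ Finset.univ.filter (fun i : Fin N => (i : ℕ) < k), b i := by
  unfold Maj pSum
  rw [aux_sortDesc a ha, aux_sortDesc b hb]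
  refine ⟨fun h k _ => h.1 k, fun h => ⟨fun k => ?_, hs⟩⟩
  rcases le_total k N with hk | hk
  · exact h k hk
  · rw [aux_ge a k hk, aux_ge b k hk, hs]

/-- The β-construction for the least upper bound in the majorization lattice:
`b_k = max(P_p(k), P_q(k)) − max(P_p(k−1), P_q(k−1))` where `P_p(k)` is the
`k`-th partial sum.  (1) every common upper bound `t` of `p, q` dominates the
partial sums of `β(p,q)`; (2) if `β(p,q)` is nonincreasing then it is the least
upper bound `p ∨ q`. -/
theorem beta_construction_lub (N : ℕ) (c : ℝ) (hc : 0 < c)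
    (p q : Fin N → ℝ) (hp : p ∈ Pset N c) (hq : q ∈ Pset N c) :
    let Pp : ℕ → ℝ := fun k => ∑ i ∈ Finset.univ.filter (fun i : Fin N => (i : ℕ) < k), p i
    let Pq : ℕ → ℝ := fun k => ∑ i ∈ Finset.univ.filter (fun i : Fin N => (i : ℕ) < k), q i
    let b : Fin N → ℝ := fun k => max (Pp ((k : ℕ) + 1)) (Pq ((k : ℕ) + 1)) -
      max (Pp (k : ℕ)) (Pq (k : ℕ))
    (∀ t ∈ Pset N c, Maj p t → Maj q t → ∀ k : ℕ, k ≤ N →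
      ∑ i ∈ Finset.univ.filter (fun i : Fin N => (i : ℕ) < k), b i ≤
        ∑ i ∈ Finset.univ.filter (fun i : Fin N => (i : ℕ) < k), t i) ∧
    ((∀ i j : Fin N, i ≤ j → b j ≤ b i) →
      b ∈ Pset N c ∧ Maj p b ∧ Maj q b ∧
        ∀ t ∈ Pset N c, Maj p t → Maj q t → Maj b t) := by
  intro Pp Pq b
  have hB : ∀ k ≤ N, ∑ i ∈ Finset.univ.filter (fun i : Fin N => (i : ℕ) < k), b i =
      max (Pp k) (Pq k) := by
    intro k
    induction k with
    | zero => intro _; simp [Pp, Pq]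
    | succ k ih =>
      intro hk
      rw [aux_succ b k hk, ih (by omega)]
      simp [b]
  obtain ⟨hp1, hp2, hp3⟩ := hp
  obtain ⟨hq1, hq2, hq3⟩ := hq
  have hbs : ∑ i, b i = c := by
    rw [← aux_ge b N le_rfl, hB N le_rfl]
    simp only [Pp, Pq]
    rw [aux_ge p N le_rfl, aux_ge q N le_rfl, hp3, hq3, max_self]
  have key : ∀ t ∈ Pset N c, Maj p t → Maj q t → ∀ k : ℕ, k ≤ N →
      ∑ i ∈ Finset.univ.filter (fun i : Fin N => (i : ℕ) < k), b i ≤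
        ∑ i ∈ Finset.univ.filter (fun i : Fin N => (i : ℕ) < k), t i := by
    rintro t ⟨_, ht2, ht3⟩ hpt hqt k hk
    rw [hB k hk]
    exact max_le ((aux_maj p t hp2 ht2 (by rw [hp3, ht3])).1 hpt k hk)
      ((aux_maj q t hq2 ht2 (by rw [hq3, ht3])).1 hqt k hk)
  refine ⟨key, fun hb => ⟨⟨fun i => ?_, hb, hbs⟩, ?_, ?_, ?_⟩⟩
  · have e1 : Pp ((i : ℕ) + 1) = Pp i + p i := aux_succ p i i.2
    have e2 : Pq ((i : ℕ) + 1) = Pq i + q i := aux_succ q i i.2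
    have h1 := hp1 i
    have h2 := hq1 i
    simp only [b]
    rw [e1, e2]
    constructor
    · rw [sub_nonneg]
      exact max_le_max (by linarith) (by linarith)
    · rw [sub_le_iff_le_add]
      refine max_le ?_ ?_
      · linarith [le_max_left (Pp i) (Pq i)]
      · linarith [le_max_right (Pp i) (Pq i)]
  · rw [aux_maj p b hp2 hb (by rw [hp3, hbs])]
    intro k hk
    rw [hB k hk]
    exact le_max_left _ _
  · rw [aux_maj q b hq2 hb (by rw [hq3, hbs])]
    intro k hk
    rw [hB k hk]
    exact le_max_right _ _
  · intro t ht hpt hqt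
    rw [aux_maj b t hb ht.2.1 (by rw [hbs, ht.2.2])]
    exact key t ht hpt hqt
end

section
/- Let p = (0.6, 0.15, 0.15, 0.1), q = (0.5, 0.25, 0.2, 0.05), t = (0.6, 0.15, 0.2, 0.05), and s = (0.6, 0.175, 0.175, 0.05). Then: (1) p ≺ t and q ≺ t; (2) p ≺ s and q ≺ s; (3) s ≺ t but s ≠ t↓ (indeed t↓ ⊀ s); and (4) s is the least upper bound p ∨ q, i.e. every x ∈ P^4 (total sum 1) with p ≺ x and q ≺ x satisfies s ≺ x. Hence the vector t built from the componentwise maxima of partial sums is an upper bound but not the least upper bound of p and q under majorization. -/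
theorem sortDesc_eq_comp {N : ℕ} (a b : Fin N → ℝ) (σ : Equiv.Perm (Fin N))
    (hb : Antitone b) (h : b = a ∘ σ) : sortDesc a = b := by
  have h1 : Monotone (a ∘ (Fin.revPerm.trans σ : Equiv.Perm (Fin N))) := by
    intro i j hij
    have h2 := hb (Fin.rev_le_rev.mpr hij)
    rw [h] at h2
    simpa using h2
  have h3 := Tuple.comp_sort_eq_comp_iff_monotone.mpr h1
  funext i
  have h4 := congrFun h3 (Fin.rev i)
  rw [h]
  simpa [sortDesc] using h4.symm

theorem pSum_four {a b : Fin 4 → ℝ} (h : sortDesc a = b) :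
    pSum a 0 = 0 ∧ pSum a 1 = b 0 ∧ pSum a 2 = b 0 + b 1 ∧ pSum a 3 = b 0 + b 1 + b 2 ∧
      ∀ k, pSum a (k + 4) = b 0 + b 1 + b 2 + b 3 := by
  unfold pSum
  rw [h]
  refine ⟨?_, ?_, ?_, ?_, fun k => ?_⟩ <;> simp [Finset.sum_filter, Fin.sum_univ_four]

theorem maj_four {a a' b b' : Fin 4 → ℝ} (ha : sortDesc a = a') (hb : sortDesc b = b')
    (hs : ∑ i, a i = ∑ i, b i) :
    Maj a b ↔ (a' 0 ≤ b' 0 ∧ a' 0 + a' 1 ≤ b' 0 + b' 1 ∧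
      a' 0 + a' 1 + a' 2 ≤ b' 0 + b' 1 + b' 2 ∧
      a' 0 + a' 1 + a' 2 + a' 3 ≤ b' 0 + b' 1 + b' 2 + b' 3) := by
  obtain ⟨a0, a1, a2, a3, a4⟩ := pSum_four ha
  obtain ⟨b0, b1, b2, b3, b4⟩ := pSum_four hb
  constructor
  · rintro ⟨h, -⟩
    have h1 := h 1
    have h2 := h 2
    have h3 := h 3
    have h4 := h (0 + 4)
    rw [a1, b1] at h1
    rw [a2, b2] at h2
    rw [a3, b3] at h3
    rw [a4, b4] at h4
    exact ⟨h1, h2, h3, h4⟩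
  · rintro ⟨h1, h2, h3, h4⟩
    refine ⟨fun k => ?_, hs⟩
    match k with
    | 0 => rw [a0, b0]
    | 1 => rwa [a1, b1]
    | 2 => rwa [a2, b2]
    | 3 => rwa [a3, b3]
    | k + 4 => rwa [a4, b4]

theorem antitone_four {a : Fin 4 → ℝ} (h1 : a 1 ≤ a 0) (h2 : a 2 ≤ a 1) (h3 : a 3 ≤ a 2) :
    Antitone a := by
  rw [Fin.antitone_iff_succ_le]
  intro i
  fin_cases i
  · exact h1
  · exact h2
  · exact h3

theorem sortDesc_antitone {N : ℕ} {a : Fin N → ℝ} (h : Antitone a) : sortDesc a = a :=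
  sortDesc_eq_comp a a (Equiv.refl _) h rfl

/-- Counterexample showing the partial-sum-maxima vector `t` is an upper bound
but not the least upper bound: for `p = (0.6,0.15,0.15,0.1)`,
`q = (0.5,0.25,0.2,0.05)`, `t = (0.6,0.15,0.2,0.05)`, and
`s = (0.6,0.175,0.175,0.05)`, one has `p,q ≺ t`, `p,q ≺ s`, `s ≺ t` with
`s ≠ t↓` (indeed `t↓ ⊀ s`), and `s = p ∨ q` is the least upper bound. -/
theorem partial_sum_maxima_not_least_upper_bound :
    let p : Fin 4 → ℝ := ![0.6, 0.15, 0.15, 0.1]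
    let q : Fin 4 → ℝ := ![0.5, 0.25, 0.2, 0.05]
    let t : Fin 4 → ℝ := ![0.6, 0.15, 0.2, 0.05]
    let s : Fin 4 → ℝ := ![0.6, 0.175, 0.175, 0.05]
    (Maj p t ∧ Maj q t) ∧
    (Maj p s ∧ Maj q s) ∧
    (Maj s t ∧ s ≠ sortDesc t ∧ ¬ Maj (sortDesc t) s) ∧
    (∀ x ∈ Pset 4 1, Maj p x → Maj q x → Maj s x) := by
  intro p q t s
  have hp : sortDesc p = p := sortDesc_antitone (by
    apply antitone_four <;> simp [p] <;> norm_num)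
  have hq : sortDesc q = q := sortDesc_antitone (by
    apply antitone_four <;> simp [q] <;> norm_num)
  have hs : sortDesc s = s := sortDesc_antitone (by
    apply antitone_four <;> simp [s] <;> norm_num)
  have hd : Antitone (![0.6, 0.2, 0.15, 0.05] : Fin 4 → ℝ) := by
    apply antitone_four <;> simp <;> norm_num
  have ht : sortDesc t = ![0.6, 0.2, 0.15, 0.05] := by
    apply sortDesc_eq_comp t _ (Equiv.swap 1 2) hd
    funext i
    fin_cases i
    · rw [Function.comp_apply, show Equiv.swap (1 : Fin 4) 2 _ = 0 from by decide]; simp [t]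
    · rw [Function.comp_apply, show Equiv.swap (1 : Fin 4) 2 _ = 2 from by decide]; simp [t]
    · rw [Function.comp_apply, show Equiv.swap (1 : Fin 4) 2 _ = 1 from by decide]; simp [t]
    · rw [Function.comp_apply, show Equiv.swap (1 : Fin 4) 2 _ = 3 from by decide]; simp [t]
  have sp : ∑ i, p i = 1 := by simp [p, Fin.sum_univ_four]; norm_num
  have sq : ∑ i, q i = 1 := by simp [q, Fin.sum_univ_four]; norm_num
  have st : ∑ i, t i = 1 := by simp [t, Fin.sum_univ_four]; norm_num
  have ss : ∑ i, s i = 1 := by simp [s, Fin.sum_univ_four]; norm_num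
  refine ⟨⟨?_, ?_⟩, ⟨?_, ?_⟩, ⟨?_, ?_, ?_⟩, ?_⟩
  · rw [maj_four hp ht (sp.trans st.symm)]
    simp [p]; norm_num
  · rw [maj_four hq ht (sq.trans st.symm)]
    simp [q]; norm_num
  · rw [maj_four hp hs (sp.trans ss.symm)]
    simp [p, s]; norm_num
  · rw [maj_four hq hs (sq.trans ss.symm)]
    simp [q, s]; norm_num
  · rw [maj_four hs ht (ss.trans st.symm)]
    simp [s]; norm_num
  · rw [ht]
    intro h
    have h1 := congrFun h 1
    simp [s] at h1
    norm_num at h1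
  · rw [ht]
    intro h
    rw [maj_four (sortDesc_antitone hd) hs h.2] at h
    have h1 := h.2.1
    simp [s] at h1
    norm_num at h1
  · rintro x ⟨-, hx, sx⟩ h1 h2
    have hxs : sortDesc x = x := sortDesc_antitone fun i j hij => hx i j hij
    rw [maj_four hp hxs (sp.trans sx.symm)] at h1
    rw [maj_four hq hxs (sq.trans sx.symm)] at h2
    rw [maj_four hs hxs (ss.trans sx.symm)]
    have h3 := hx 1 2 (by decide)
    rw [Fin.sum_univ_four] at sx
    obtain ⟨a1, a2, a3, a4⟩ := h1
    obtain ⟨b1, b2, b3, b4⟩ := h2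
    simp [p, q, s] at *
    norm_num at *
    refine ⟨?_, ?_, ?_, ?_⟩ <;> linarith
end
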